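/- Let $n\ge 1$ and let $\varphi$ be a CNF formula with variables $x_1,\dots,x_n$ and clauses $c_1,\dots,c_m$, each clause of size two or three, such that each variable occurs exactly three times in $\varphi$, at least once positively and at least once negatively. Let $G$ be any graph constructed from $\varphi$ as follows. For each $i\in[n]$ there are five vertices $u_i,v_i,p_i,r_i,n_i$ and five edges $\{u_i,v_i\},\{v_i,p_i\},\{p_i,r_i\},\{r_i,n_i\},\{n_i,v_i\}$; for each $i\in[n-1]$ there is an edge $\{u_i,u_{i+1}\}$; for each clause $c_j$ there is one vertex, also denoted $c_j$. For each $i\in[n]$ choose a bijection between $\{p_i,r_i,n_i\}$ and the three occurrences of $x_i$ in $\varphi$ such that $p_i$ corresponds to a positive and $n_i$ to a negative occurrence, and join each of $p_i,r_i,n_i$ by an edge to the vertex of the clause containing its corresponding occurrence. Let $\chi:E(G)\to\{1,\dots,9\}$ be any edge-coloring such that $\chi(\{p_i,r_i\})=1$ and $\chi(\{r_i,n_i\})=2$ for all $i$; every edge incident to some $u_i$ or $v_i$ has color $3$; and for each $j$ the edges incident to $c_j$ have pairwise distinct colors, in $\{4,5,6\}$ for edges corresponding to positive occurrences and in $\{7,8,9\}$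 for edges corresponding to negative occurrences. Let $c$ be the symmetric cost function on $\{1,\dots,9\}$ with $c(1,2)=1$; $c(1,k)=1$ for $k\in\{4,5,6\}$; $c(2,k)=1$ for $k\in\{7,8,9\}$; $c(k,l)=1$ for all distinct $k,l\in\{4,\dots,9\}$; and all other costs $0$. The reload cost of a path with edges $e_1,\dots,e_\ell$ is $\sum_{i=2}^{\ell}c(\chi(e_{i-1}),\chi(e_i))$ (zero if $\ell\le 1$), and the reload diameter $\mathrm{diam}(T)$ of a tree $T$ is the maximum, over all pairs of vertices $u,v$ of $T$, of the reload cost of the unique $u$–$v$ path in $T$. Then $\varphi$ is satisfiable if and only if $G$ has a spanning tree $T$ with $\mathrm{diam}(T)=0$. -/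

import Mathlib

namespace ReloadCost

/-! ### Reload costs -/

/-- The reload cost of a sequence of colors: the sum of `c` over consecutive pairs. -/
def chainCost {X : Type*} (c : X → X → ℕ) : List X → ℕ
  | a :: b :: l => c a b + chainCost c (b :: l)
  | _ => 0

/-- The reload cost of a walk `p`, for the edge-coloring `χ` and the cost function `c`.
Only the values of `χ` on edges of the graph matter. -/
def walkCost {V X : Type*} {G : SimpleGraph V} (χ : Sym2 V → X) (c : X → X → ℕ)
    {u v : V} (p : G.Walk u v) : ℕ :=
  chainCost c (p.edges.map χ)

/-- The reload cost distance: the minimum reload cost of a path from `u` to `v`. In a tree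
this is the reload cost of the unique path from `u` to `v`. -/
noncomputable def reloadDist {V X : Type*} (G : SimpleGraph V) (χ : Sym2 V → X)
    (c : X → X → ℕ) (u v : V) : ℕ :=
  sInf {k | ∃ p : G.Walk u v, p.IsPath ∧ walkCost χ c p = k}

/-- The reload diameter of a tree: the maximum reload cost distance between two vertices. -/
noncomputable def reloadDiam {V X : Type*} [Fintype V] (T : SimpleGraph V) (χ : Sym2 V → X)
    (c : X → X → ℕ) : ℕ :=
  Finset.univ.sup fun w : V × V => reloadDist T χ c w.1 w.2

/-! ### CNF formulas -/

/-- A CNF formula with variables indexed by `Fin n` and clauses indexed by `Fin m`. A clause is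
a list of literals; the literal `(i, true)` is `x_i` and `(i, false)` is its negation. -/
abbrev Formula (n m : ℕ) := Fin m → List (Fin n × Bool)

def Formula.Satisfiable {n m : ℕ} (φ : Formula n m) : Prop :=
  ∃ σ : Fin n → Bool, ∀ j, ∃ l ∈ φ j, σ l.1 = l.2

/-- An occurrence of a literal in `φ`: a clause together with a position in it. -/
abbrev Formula.Occ {n m : ℕ} (φ : Formula n m) := (j : Fin m) × Fin (φ j).length

/-- The literal that stands at an occurrence. -/
def Formula.lit {n m : ℕ} (φ : Formula n m) (o : φ.Occ) : Fin n × Bool :=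
  (φ o.1).get o.2

/-- The occurrences (positive or negative) of the variable `x_i` in `φ`. -/
abbrev Formula.OccOf {n m : ℕ} (φ : Formula n m) (i : Fin n) := {o : φ.Occ // (φ.lit o).1 = i}

/-- The clauses have size two or three, and each variable occurs exactly three times, at least
once positively and at least once negatively. -/
structure Formula.IsRestricted {n m : ℕ} (φ : Formula n m) : Prop where
  size : ∀ j, (φ j).length = 2 ∨ (φ j).length = 3
  three : ∀ i, Nat.card (φ.OccOf i) = 3
  exists_pos : ∀ i, ∃ o : φ.OccOf i, (φ.lit o.1).2 = true
  exists_neg : ∀ i, ∃ o : φ.OccOf i, (φ.lit o.1).2 = false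

/-! ### The graph built from a formula -/

/-- The three names of the vertices `p_i`, `r_i`, `n_i`. -/
inductive Slot
  | p
  | r
  | n
  deriving DecidableEq

instance : Fintype Slot := ⟨{.p, .r, .n}, fun s => by cases s <;> decide⟩

/-- The vertices: `u i`, `v i` are `u_i`, `v_i`; `slot i .p`, `slot i .r`, `slot i .n` are
`p_i`, `r_i`, `n_i`; and `c j` is the clause vertex `c_j`. -/
inductive Vertex (n m : ℕ)
  | u (i : Fin n)
  | v (i : Fin n)
  | slot (i : Fin n) (s : Slot)
  | c (j : Fin m)
  deriving DecidableEq, Fintype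

/-- For each variable `x_i`, a bijection between `{p_i, r_i, n_i}` and the occurrences of `x_i`
such that `p_i` corresponds to a positive and `n_i` to a negative occurrence. -/
structure OccChoice {n m : ℕ} (φ : Formula n m) where
  toEquiv : ∀ i : Fin n, Slot ≃ φ.OccOf i
  pos : ∀ i, (φ.lit (toEquiv i .p).1).2 = true
  neg : ∀ i, (φ.lit (toEquiv i .n).1).2 = false

/-- The clause containing the occurrence that corresponds to the vertex `slot i s`. -/
def OccChoice.clause {n m : ℕ} {φ : Formula n m} (f : OccChoice φ) (i : Fin n) (s : Slot) :
    Fin m :=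
  (f.toEquiv i s).1.1

/-- The sign of the occurrence that corresponds to the vertex `slot i s`. -/
def OccChoice.sign {n m : ℕ} {φ : Formula n m} (f : OccChoice φ) (i : Fin n) (s : Slot) :
    Bool :=
  (φ.lit (f.toEquiv i s).1).2

/-- The edges of the graph, each listed in one direction. -/
inductive EdgeRel {n m : ℕ} {φ : Formula n m} (f : OccChoice φ) : Vertex n m → Vertex n m → Prop
  | uv (i : Fin n) : EdgeRel f (.u i) (.v i)
  | vp (i : Fin n) : EdgeRel f (.v i) (.slot i .p)
  | pr (i : Fin n) : EdgeRel f (.slot i .p) (.slot i .r)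
  | rn (i : Fin n) : EdgeRel f (.slot i .r) (.slot i .n)
  | nv (i : Fin n) : EdgeRel f (.slot i .n) (.v i)
  | uu (i i' : Fin n) (h : i.val + 1 = i'.val) : EdgeRel f (.u i) (.u i')
  | occ (i : Fin n) (s : Slot) : EdgeRel f (.slot i s) (.c (f.clause i s))

/-- The graph `G` constructed from `φ` and the chosen bijections. -/
def graph {n m : ℕ} {φ : Formula n m} (f : OccChoice φ) : SimpleGraph (Vertex n m) :=
  SimpleGraph.fromRel (EdgeRel f)

/-- `χ` restricts to an edge-coloring of `graph f` that obeys the rules of the construction;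
its values on pairs that are not edges are irrelevant. -/
structure IsColoring {n m : ℕ} {φ : Formula n m} (f : OccChoice φ)
    (χ : Sym2 (Vertex n m) → ℕ) : Prop where
  pr : ∀ i, χ s(.slot i .p, .slot i .r) = 1
  rn : ∀ i, χ s(.slot i .r, .slot i .n) = 2
  uv : ∀ e ∈ (graph f).edgeSet, ∀ i, (Vertex.u i ∈ e ∨ Vertex.v i ∈ e) → χ e = 3
  pos : ∀ i s, f.sign i s = true →
    χ s(.slot i s, .c (f.clause i s)) ∈ ({4, 5, 6} : Set ℕ)
  neg : ∀ i s, f.sign i s = false →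
    χ s(.slot i s, .c (f.clause i s)) ∈ ({7, 8, 9} : Set ℕ)
  distinct : ∀ j, ∀ e ∈ (graph f).edgeSet, ∀ e' ∈ (graph f).edgeSet,
    Vertex.c j ∈ e → Vertex.c j ∈ e' → e ≠ e' → χ e ≠ χ e'

/-- The symmetric cost function on the colors `1, …, 9`: `c(1,2) = 1`; `c(1,i) = 1` for
`i ∈ {4,5,6}`; `c(2,i) = 1` for `i ∈ {7,8,9}`; `c(i,j) = 1` for distinct `i, j ∈ {4,…,9}`;
all other costs are `0`. -/
def cost (x y : ℕ) : ℕ :=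
  if (x = 1 ∧ y = 2) ∨ (x = 2 ∧ y = 1) ∨
      (x = 1 ∧ 4 ≤ y ∧ y ≤ 6) ∨ (y = 1 ∧ 4 ≤ x ∧ x ≤ 6) ∨
      (x = 2 ∧ 7 ≤ y ∧ y ≤ 9) ∨ (y = 2 ∧ 7 ≤ x ∧ x ≤ 9) ∨
      (4 ≤ x ∧ x ≤ 9 ∧ 4 ≤ y ∧ y ≤ 9 ∧ x ≠ y)
  then 1 else 0

end ReloadCost

open ReloadCost

namespace ReloadCost

/-! ### Reload diameter zero is a local condition -/

section Local

variable {V X : Type*} {T : SimpleGraph V} {χ : Sym2 V → X} {c : X → X → ℕ}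

/-- All turns in `T` are free: two distinct edges at a common vertex have reload cost zero. -/
def FreeTurns (T : SimpleGraph V) (χ : Sym2 V → X) (c : X → X → ℕ) : Prop :=
  ∀ w a b, T.Adj a w → T.Adj w b → a ≠ b → c (χ s(a, w)) (χ s(w, b)) = 0

theorem FreeTurns.walkCost_eq_zero (h : FreeTurns T χ c) {u v : V} (p : T.Walk u v)
    (hp : p.IsPath) : walkCost χ c p = 0 := by
  induction p with
  | nil => rfl
  | cons h₁ q ih =>
    cases q with
    | nil => rfl
    | cons h₂ q =>
      have hq := ih hp.of_cons
      rw [SimpleGraph.Walk.cons_isPath_iff] at hp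
      have hne := hp.2
      simp only [SimpleGraph.Walk.support_cons, List.mem_cons, not_or] at hne
      have hc := h _ _ _ h₁ h₂ (fun e => hne.2 (e ▸ q.start_mem_support))
      simp only [walkCost, SimpleGraph.Walk.edges_cons, List.map_cons, chainCost] at hq ⊢
      omega

theorem walkCost_eq_reloadDist (hT : T.IsAcyclic) {u v : V} (p : T.Walk u v) (hp : p.IsPath) :
    walkCost χ c p = reloadDist T χ c u v := by
  have hset : {k | ∃ q : T.Walk u v, q.IsPath ∧ walkCost χ c q = k} = {walkCost χ c p} := by
    ext k
    constructor
    · rintro ⟨q, hq, rfl⟩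
      have := (hT.subsingleton_path u v).elim ⟨q, hq⟩ ⟨p, hp⟩
      rw [Subtype.mk.injEq] at this
      rw [this]
      rfl
    · rintro rfl
      exact ⟨p, hp, rfl⟩
  rw [reloadDist, hset, csInf_singleton]

/-- A tree has reload diameter zero if and only if all its turns are free. -/
theorem reloadDiam_eq_zero_iff [Fintype V] (hT : T.IsTree) :
    reloadDiam T χ c = 0 ↔ FreeTurns T χ c := by
  have hdiam : reloadDiam T χ c = 0 ↔ ∀ u v, reloadDist T χ c u v = 0 := by
    rw [reloadDiam, ← Nat.bot_eq_zero, Finset.sup_eq_bot_iff]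
    exact ⟨fun h u v => h (u, v) (Finset.mem_univ _), fun h w _ => h w.1 w.2⟩
  rw [hdiam]
  constructor
  · intro h w a b ha hb hab
    have hp : (SimpleGraph.Walk.cons ha (.cons hb .nil)).IsPath := by
      simp [SimpleGraph.Walk.cons_isPath_iff, ha.ne, hb.ne, hab]
    have := walkCost_eq_reloadDist (χ := χ) (c := c) hT.isAcyclic _ hp
    rw [h] at this
    simpa [walkCost, chainCost] using this
  · intro h u v
    obtain ⟨p, hp⟩ := hT.connected.exists_isPath u v
    rw [← walkCost_eq_reloadDist hT.isAcyclic p hp, h.walkCost_eq_zero p hp]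

end Local

/-! ### Trees from parent functions -/

/-- The graph joining each vertex to its parent. -/
def parentGraph {V : Type*} (parent : V → V) : SimpleGraph V :=
  SimpleGraph.fromRel fun x y => parent x = y

theorem parentGraph_isTree {V : Type*} [Fintype V] (parent : V → V) (root : V) (rank : V → ℕ)
    (hroot : parent root = root) (h : ∀ x, x ≠ root → rank (parent x) < rank x) :
    (parentGraph parent).IsTree := by
  classical
  have hreach : ∀ k x, rank x = k → (parentGraph parent).Reachable x root := by
    intro k
    induction k using Nat.strong_induction_on with
    | _ k ih =>
      rintro x rfl
      by_cases hx : x = root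
      · rw [hx]
      · have hlt := h x hx
        have hadj : (parentGraph parent).Adj x (parent x) := by
          refine (SimpleGraph.fromRel_adj _ _ _).2 ⟨fun e => ?_, .inl rfl⟩
          rw [← e] at hlt
          exact lt_irrefl _ hlt
        exact hadj.reachable.trans (ih _ hlt _ rfl)
  have hconn : (parentGraph parent).Connected :=
    { preconnected := fun x y => (hreach _ x rfl).trans (hreach _ y rfl).symm
      nonempty := ⟨root⟩ }
  refine SimpleGraph.isTree_iff_connected_and_card.2 ⟨hconn, le_antisymm ?_ ?_⟩
  · have hsub : (parentGraph parent).edgeSet ⊆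
        ((Finset.univ.erase root).image fun x => s(x, parent x) : Finset (Sym2 V)) := by
      intro e
      induction e using Sym2.ind with
      | _ x y =>
        intro he
        obtain ⟨hne, hxy⟩ := (SimpleGraph.fromRel_adj _ _ _).1 ((SimpleGraph.mem_edgeSet _).1 he)
        rw [Finset.coe_image]
        rcases hxy with rfl | rfl
        · exact ⟨x, by simpa using fun e : x = root => hne (by rw [e, hroot]), rfl⟩
        · exact ⟨y, by simpa using fun e : y = root => hne (by rw [e, hroot]), Sym2.eq_swap⟩
    have hle : Nat.card (parentGraph parent).edgeSet ≤ (Finset.univ.erase root).card := by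
      refine le_trans (Nat.card_mono (Finset.finite_toSet _) hsub) ?_
      rw [Nat.card_coe_set_eq, Set.ncard_coe_finset]
      exact Finset.card_image_le
    have hpos : 0 < Fintype.card V := Fintype.card_pos_iff.2 ⟨root⟩
    rw [Finset.card_erase_of_mem (Finset.mem_univ _), Finset.card_univ] at hle
    rw [Nat.card_eq_fintype_card (α := V)]
    omega
  · exact hconn.card_vert_le_card_edgeSet_add_one

/-! ### The graph of a formula -/

section Graph

variable {n m : ℕ} {φ : Formula n m} {f : OccChoice φ} {χ : Sym2 (Vertex n m) → ℕ}

theorem lit_toEquiv (f : OccChoice φ) (i : Fin n) (s : Slot) :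
    φ.lit (f.toEquiv i s).1 = (i, f.sign i s) :=
  Prod.ext (f.toEquiv i s).2 rfl

/-- Satisfiability in terms of the vertices `p_i`, `r_i`, `n_i`. -/
theorem satisfiable_iff (f : OccChoice φ) :
    φ.Satisfiable ↔ ∃ σ : Fin n → Bool, ∀ j, ∃ i s, f.clause i s = j ∧ f.sign i s = σ i := by
  refine exists_congr fun σ => forall_congr' fun j => ⟨?_, ?_⟩
  · rintro ⟨l, hl, hσ⟩
    obtain ⟨k, rfl⟩ := List.get_of_mem hl
    let o : φ.Occ := ⟨j, k⟩
    refine ⟨(φ.lit o).1, (f.toEquiv (φ.lit o).1).symm ⟨o, rfl⟩, ?_, ?_⟩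
    · simp [OccChoice.clause, o]
    · simp only [OccChoice.sign, Equiv.apply_symm_apply]
      exact hσ.symm
  · rintro ⟨i, s, rfl, hs⟩
    refine ⟨φ.lit (f.toEquiv i s).1, List.get_mem _ _, ?_⟩
    rw [lit_toEquiv]
    exact hs.symm

theorem graph_adj_c {x : Vertex n m} {j : Fin m} (h : (graph f).Adj x (.c j)) :
    ∃ i s, x = .slot i s ∧ f.clause i s = j := by
  obtain ⟨-, h | h⟩ := (SimpleGraph.fromRel_adj _ _ _).1 h
  · cases h with
    | occ i s => exact ⟨i, s, rfl, rfl⟩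
  · cases h

theorem graph_adj_r {x : Vertex n m} {i : Fin n} (h : (graph f).Adj (.slot i .r) x) :
    x = .slot i .p ∨ x = .slot i .n ∨ x = .c (f.clause i .r) := by
  obtain ⟨-, h | h⟩ := (SimpleGraph.fromRel_adj _ _ _).1 h <;> cases h <;> simp

theorem cost_three_left (x : ℕ) : cost 3 x = 0 := by
  simp [cost]

theorem cost_three_right (x : ℕ) : cost x 3 = 0 := by
  simp [cost]

theorem cost_comm (x y : ℕ) : cost x y = cost y x := by
  unfold cost
  congr 1
  apply propext
  omega

theorem IsColoring.pos_bounds (hχ : IsColoring f χ) {i : Fin n} {s : Slot}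
    (h : f.sign i s = true) :
    4 ≤ χ s(.slot i s, .c (f.clause i s)) ∧ χ s(.slot i s, .c (f.clause i s)) ≤ 6 := by
  have := hχ.pos i s h
  simp only [Set.mem_insert_iff, Set.mem_singleton_iff] at this
  omega

theorem IsColoring.neg_bounds (hχ : IsColoring f χ) {i : Fin n} {s : Slot}
    (h : f.sign i s = false) :
    7 ≤ χ s(.slot i s, .c (f.clause i s)) ∧ χ s(.slot i s, .c (f.clause i s)) ≤ 9 := by
  have := hχ.neg i s h
  simp only [Set.mem_insert_iff, Set.mem_singleton_iff] at this
  omega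

theorem IsColoring.occ_bounds (hχ : IsColoring f χ) (i : Fin n) (s : Slot) :
    4 ≤ χ s(.slot i s, .c (f.clause i s)) ∧ χ s(.slot i s, .c (f.clause i s)) ≤ 9 := by
  cases h : f.sign i s
  · have := hχ.neg_bounds h; omega
  · have := hχ.pos_bounds h; omega

theorem IsColoring.cost_pr_occ (hχ : IsColoring f χ) {i : Fin n} (h : f.sign i .r = false) :
    cost (χ s(.slot i .p, .slot i .r)) (χ s(.slot i .r, .c (f.clause i .r))) = 0 := by
  have hb := hχ.neg_bounds h
  rw [hχ.pr, cost, if_neg (by omega)]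

theorem IsColoring.cost_nr_occ (hχ : IsColoring f χ) {i : Fin n} (h : f.sign i .r = true) :
    cost (χ s(.slot i .n, .slot i .r)) (χ s(.slot i .r, .c (f.clause i .r))) = 0 := by
  have hb := hχ.pos_bounds h
  rw [Sym2.eq_swap, hχ.rn, cost, if_neg (by omega)]

/-! ### From a spanning tree to an assignment -/

section Backward

variable {T : SimpleGraph (Vertex n m)}

/-- Clause vertices are leaves. -/
theorem FreeTurns.eq_of_adj_c (hχ : IsColoring f χ) (hle : T ≤ graph f)
    (hfree : FreeTurns T χ cost) {x y : Vertex n m} {j : Fin m}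
    (hx : T.Adj x (.c j)) (hy : T.Adj y (.c j)) : x = y := by
  by_contra hne
  have h0 := hfree _ _ _ hx hy.symm hne
  have hd := hχ.distinct j s(x, .c j) (hle hx) s(.c j, y) (hle hy.symm) (by simp) (by simp)
    (by rw [Sym2.eq_swap (a := Vertex.c j)]; exact fun e => hne (Sym2.congr_left.1 e))
  rw [Sym2.eq_swap (a := Vertex.c j)] at h0 hd
  obtain ⟨i, s, rfl, rfl⟩ := graph_adj_c (hle hx)
  obtain ⟨i', s', rfl, hj⟩ := graph_adj_c (hle hy)
  have h₁ := hχ.occ_bounds i s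
  have h₂ := hχ.occ_bounds i' s'
  rw [hj] at h₂
  simp only [cost, ite_eq_right_iff, one_ne_zero, imp_false] at h0
  omega

theorem FreeTurns.adj_p_or_adj_n (hχ : IsColoring f χ) (hle : T ≤ graph f)
    (hconn : T.Connected) (hfree : FreeTurns T χ cost) (i : Fin n) :
    T.Adj (.slot i .r) (.slot i .p) ∨ T.Adj (.slot i .r) (.slot i .n) := by
  by_contra! hcon
  have hclosed : ∀ x y : Vertex n m, T.Walk x y →
      (x = .slot i .r ∨ x = .c (f.clause i .r) ∧ T.Adj (.slot i .r) (.c (f.clause i .r))) →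
      (y = .slot i .r ∨ y = .c (f.clause i .r) ∧ T.Adj (.slot i .r) (.c (f.clause i .r))) := by
    intro x y p
    induction p with
    | nil => exact id
    | cons h _ ih =>
      intro hx
      apply ih
      rcases hx with rfl | ⟨rfl, hr⟩
      · rcases graph_adj_r (hle h) with rfl | rfl | rfl
        · exact absurd h hcon.1
        · exact absurd h hcon.2
        · exact .inr ⟨rfl, h⟩
      · exact .inl (hfree.eq_of_adj_c hχ hle h.symm hr)
  obtain ⟨p⟩ := hconn.preconnected (.slot i .r) (.v i)
  simpa using hclosed _ _ p (.inl rfl)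

theorem FreeTurns.sign_eq_true_iff (hχ : IsColoring f χ) (hle : T ≤ graph f)
    (hconn : T.Connected) (hfree : FreeTurns T χ cost) {i : Fin n} {s : Slot}
    (h : T.Adj (.slot i s) (.c (f.clause i s))) :
    f.sign i s = true ↔ T.Adj (.slot i .r) (.slot i .n) := by
  have h₁ := hχ.pr i
  have h₂ := hχ.rn i
  constructor
  · intro hs
    by_contra hn
    have hp := (hfree.adj_p_or_adj_n hχ hle hconn i).resolve_right hn
    have hb := hχ.pos_bounds hs
    cases s with
    | p =>
      have := hfree _ _ _ hp h (by simp)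
      rw [Sym2.eq_swap, h₁] at this
      simp [cost, hb] at this
    | r =>
      have := hfree _ _ _ hp.symm h (by simp)
      rw [h₁] at this
      simp [cost, hb] at this
    | n => exact absurd (hs.symm.trans (f.neg i)) (by simp)
  · intro hn
    by_contra hs
    rw [Bool.not_eq_true] at hs
    have hb := hχ.neg_bounds hs
    cases s with
    | p => exact absurd (hs.symm.trans (f.pos i)) (by simp)
    | r =>
      have := hfree _ _ _ hn.symm h (by simp)
      rw [Sym2.eq_swap, h₂] at this
      simp [cost, hb] at this
    | n =>
      have := hfree _ _ _ hn h (by simp)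
      rw [h₂] at this
      simp [cost, hb] at this

theorem FreeTurns.satisfiable (hn : 0 < n) (hχ : IsColoring f χ) (hle : T ≤ graph f)
    (hconn : T.Connected) (hfree : FreeTurns T χ cost) : φ.Satisfiable := by
  classical
  refine (satisfiable_iff f).2 ⟨fun i => decide (T.Adj (.slot i .r) (.slot i .n)), fun j => ?_⟩
  have : Nontrivial (Vertex n m) := ⟨.u ⟨0, hn⟩, .v ⟨0, hn⟩, by simp⟩
  obtain ⟨x, hx⟩ := hconn.preconnected.exists_adj_of_nontrivial (.c j)
  obtain ⟨i, s, rfl, rfl⟩ := graph_adj_c (hle hx.symm)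
  refine ⟨i, s, rfl, ?_⟩
  rw [Bool.eq_iff_iff, decide_eq_true_iff]
  exact hfree.sign_eq_true_iff hχ hle hconn hx.symm

end Backward

/-! ### From an assignment to a spanning tree -/

section Forward

/-- The parent function of the tree of an assignment `σ`, rooted at `u_1`, where the clause
vertex `c_j` hangs from the vertex `slot (g j) (t j)`. -/
def parent (σ : Fin n → Bool) (g : Fin m → Fin n) (t : Fin m → Slot) : Vertex n m → Vertex n m
  | .u i => .u ⟨i.val - 1, lt_of_le_of_lt (Nat.sub_le _ _) i.isLt⟩
  | .v i => .u i
  | .slot i .p => .v i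
  | .slot i .n => .v i
  | .slot i .r => if σ i then .slot i .n else .slot i .p
  | .c j => .slot (g j) (t j)

/-- A rank function decreasing along `parent`. -/
def rank : Vertex n m → ℕ
  | .u i => i.val
  | .v _ => n
  | .slot _ .p => n + 1
  | .slot _ .n => n + 1
  | .slot _ .r => n + 2
  | .c _ => n + 3

variable {σ : Fin n → Bool} {g : Fin m → Fin n} {t : Fin m → Slot}

theorem rank_parent_lt (hn : 0 < n) (x : Vertex n m) (hx : x ≠ .u ⟨0, hn⟩) :
    rank (parent σ g t x) < rank x := by
  cases x with
  | u i =>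
    have : i.val ≠ 0 := fun h => hx (congrArg _ (Fin.ext h))
    simp only [parent, rank]
    omega
  | v i => exact i.isLt
  | slot i s =>
    cases s with
    | p => simp [parent, rank]
    | r => cases h : σ i <;> simp [parent, rank, h]
    | n => simp [parent, rank]
  | c j =>
    cases h : t j <;> simp [parent, rank, h]

theorem parentGraph_le_graph (hg : ∀ j, f.clause (g j) (t j) = j) :
    parentGraph (parent σ g t) ≤ graph f := by
  have key : ∀ x : Vertex n m, x ≠ parent σ g t x → (graph f).Adj x (parent σ g t x) := by
    intro x hx
    refine (SimpleGraph.fromRel_adj _ _ _).2 ⟨hx, ?_⟩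
    cases x with
    | u i =>
      refine .inr (.uu _ _ ?_)
      have : i.val ≠ 0 := by
        intro h
        apply hx
        simp only [parent, Vertex.u.injEq]
        ext
        simp [h]
      simp only
      omega
    | v i => exact .inr (.uv i)
    | slot i s =>
      cases s with
      | p => exact .inr (.vp i)
      | r =>
        cases h : σ i
        · simpa [parent, h] using .inr (.pr i)
        · simpa [parent, h] using .inl (.rn i)
      | n => exact .inl (.nv i)
    | c j =>
      right
      have := EdgeRel.occ (f := f) (g j) (t j)
      rwa [hg j] at this
  intro x y h
  obtain ⟨hne, rfl | rfl⟩ := (SimpleGraph.fromRel_adj _ _ _).1 h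
  · exact key x hne
  · exact (key y hne.symm).symm

theorem eq_of_parentGraph_adj_c {x : Vertex n m} {j : Fin m}
    (h : (parentGraph (parent σ g t)).Adj x (.c j)) : x = .slot (g j) (t j) := by
  obtain ⟨-, h | h⟩ := (SimpleGraph.fromRel_adj _ _ _).1 h
  · cases x with
    | slot i s =>
      cases s with
      | r => cases hi : σ i <;> simp [parent, hi] at h
      | _ => cases h
    | _ => cases h
  · exact h.symm

/-- The neighbors of the vertices `p_i`, `r_i`, `n_i` in the tree of `σ`. -/
theorem parentGraph_adj_slot (hg : ∀ j, f.clause (g j) (t j) = j)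
    (hσ : ∀ j, f.sign (g j) (t j) = σ (g j)) {x : Vertex n m} {i : Fin n} {s : Slot}
    (h : (parentGraph (parent σ g t)).Adj x (.slot i s)) :
    (x = .v i) ∨ (x = .slot i .r ∧ s = .p ∧ σ i = false) ∨
      (x = .slot i .r ∧ s = .n ∧ σ i = true) ∨
      (x = .slot i .p ∧ s = .r ∧ σ i = false) ∨ (x = .slot i .n ∧ s = .r ∧ σ i = true) ∨
      (x = .c (f.clause i s) ∧ f.sign i s = σ i) := by
  obtain ⟨-, h | h⟩ := (SimpleGraph.fromRel_adj _ _ _).1 h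
  · cases x with
    | u i' => cases h
    | v i' => cases h
    | slot i' s' =>
      cases s' with
      | p => cases h
      | n => cases h
      | r =>
        cases hi : σ i' <;> simp only [parent, hi] at h <;> cases h <;> simp [hi]
    | c j =>
      obtain ⟨rfl, rfl⟩ := Vertex.slot.inj h
      simp [hg, hσ]
  · cases s with
    | p => exact .inl h.symm
    | n => exact .inl h.symm
    | r => cases hi : σ i <;> simp [parent, hi] at h <;> simp [← h]

theorem freeTurns_parentGraph (hχ : IsColoring f χ) (hg : ∀ j, f.clause (g j) (t j) = j)
    (hσ : ∀ j, f.sign (g j) (t j) = σ (g j)) :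
    FreeTurns (parentGraph (parent σ g t)) χ cost := by
  have hle := parentGraph_le_graph (σ := σ) hg
  intro w a b ha hb hab
  cases w with
  | u i => rw [hχ.uv _ (hle ha) i (by simp), cost_three_left]
  | v i => rw [hχ.uv _ (hle ha) i (by simp), cost_three_left]
  | c j =>
    exact absurd ((eq_of_parentGraph_adj_c ha).trans (eq_of_parentGraph_adj_c hb.symm).symm) hab
  | slot i s =>
    by_cases hav : a = .v i
    · rw [hχ.uv _ (hle ha) i (by simp [hav]), cost_three_left]
    by_cases hbv : b = .v i
    · rw [hχ.uv s(.slot i s, b) (hle hb) i (by simp [hbv]), cost_three_right]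
    have hp : f.sign i .p = true := f.pos i
    have hn : f.sign i .n = false := f.neg i
    have ha' := (parentGraph_adj_slot hg hσ ha).resolve_left hav
    have hb' := (parentGraph_adj_slot hg hσ hb.symm).resolve_left hbv
    have hfalse := hχ.cost_pr_occ (i := i)
    have htrue := hχ.cost_nr_occ (i := i)
    rcases ha' with ⟨rfl, rfl, hi⟩ | ⟨rfl, rfl, hi⟩ | ⟨rfl, rfl, hi⟩ | ⟨rfl, rfl, hi⟩ | ⟨rfl, hi⟩
    · simp_all
    · simp_all
    · rcases hb' with hb' | hb' | hb' | hb' | ⟨rfl, hi'⟩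
      iterate 4 simp_all
      exact hfalse (hi'.trans hi)
    · rcases hb' with hb' | hb' | hb' | hb' | ⟨rfl, hi'⟩
      iterate 4 simp_all
      exact htrue (hi'.trans hi)
    · rcases hb' with ⟨rfl, rfl, hi'⟩ | ⟨rfl, rfl, hi'⟩ | ⟨rfl, rfl, hi'⟩ | ⟨rfl, rfl, hi'⟩ |
        ⟨rfl, hi'⟩
      · simp_all
      · simp_all
      · rw [cost_comm, Sym2.eq_swap, Sym2.eq_swap (a := Vertex.c _)]
        exact hfalse (hi.trans hi')
      · rw [cost_comm, Sym2.eq_swap, Sym2.eq_swap (a := Vertex.c _)]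
        exact htrue (hi.trans hi')
      · exact absurd rfl hab

end Forward

end Graph

end ReloadCost

theorem stmt5 (n m : ℕ) (hn : 0 < n) (φ : Formula n m) (hφ : φ.IsRestricted)
    (f : OccChoice φ) (χ : Sym2 (Vertex n m) → ℕ) (hχ : IsColoring f χ) :
    φ.Satisfiable ↔
      ∃ T : SimpleGraph (Vertex n m), T ≤ graph f ∧ T.IsTree ∧ reloadDiam T χ cost = 0 := by
  constructor
  · intro h
    obtain ⟨σ, h⟩ := (satisfiable_iff f).1 h
    choose g t hg hσ using h
    have hT : (parentGraph (parent σ g t)).IsTree := parentGraph_isTree _ (.u ⟨0, hn⟩) rank rfl (rank_parent_lt hn)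
    exact ⟨_, parentGraph_le_graph hg, hT,
      (reloadDiam_eq_zero_iff hT).2 (freeTurns_parentGraph hχ hg hσ)⟩
  · rintro ⟨T, hle, hT, h⟩
    exact ((reloadDiam_eq_zero_iff hT).1 h).satisfiable hn hχ hle hT.connected
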